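/- arXiv:0907.3174 — 12 statements merged into one kernel-verified Lean document; each statement's English description precedes it below -/
import Mathlib

section
/- For every integer n ≥ 1, the sum of the reciprocals of the squares of the binomial coefficients satisfies: ∑_{k=0}^{n-1} (C(n,k))^{-2} = ((n+1)! · (n+1)^2 / (Γ(n+5/2) · 4^n)) · ∑_{j=0}^{n-1} (3j^3+12j^2+18j+10) · 4^j · Γ(j+5/2) / ((j+1)^2 · (j+1)! · (j+2)^3), where the identity is an equality of real numbers. -/
open Finset

/-- WZ-style telescoping identity. -/
lemma usd_telescope (n m : ℕ) (hm : m ≤ n) :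
    ∑ k ∈ Finset.range m, ((4 * (n : ℝ) + 10) * ((n : ℝ) + 1) ^ 2 * (((n + 1).choose k : ℝ) ^ 2)⁻¹
        - ((n : ℝ) + 2) ^ 3 * ((n.choose k : ℝ) ^ 2)⁻¹) =
      ((n : ℝ) + 1 - m) ^ 2 * (2 * m - 3 * ((n : ℝ) + 2)) * ((n.choose m : ℝ) ^ 2)⁻¹
        + 3 * ((n : ℝ) + 1) ^ 2 * ((n : ℝ) + 2) := by
  induction m with
  | zero => simp; ring
  | succ k ih =>
    rw [Finset.sum_range_succ, ih (by omega)]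
    have hc : (n.choose k : ℝ) ≠ 0 := by
      exact_mod_cast (Nat.choose_pos (by omega : k ≤ n)).ne'
    obtain ⟨d, rfl⟩ : ∃ d, n = k + 1 + d := ⟨n - (k + 1), by omega⟩
    have h1 := Nat.choose_mul_succ_eq (k + 1 + d) k
    have h2 := Nat.choose_succ_right_eq (k + 1 + d) k
    rw [show k + 1 + d + 1 - k = d + 2 by omega] at h1
    rw [show k + 1 + d - k = d + 1 by omega] at h2
    have e1 : (((k + 1 + d + 1).choose k : ℕ) : ℝ)
        = ((k + 1 + d).choose k : ℝ) * ((k : ℝ) + 1 + d + 1) / ((d : ℝ) + 2) := by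
      rw [eq_div_iff (by positivity)]
      exact_mod_cast h1.symm
    have e2 : (((k + 1 + d).choose (k + 1) : ℕ) : ℝ)
        = ((k + 1 + d).choose k : ℝ) * ((d : ℝ) + 1) / ((k : ℝ) + 1) := by
      rw [eq_div_iff (by positivity)]
      exact_mod_cast h2
    rw [e1, e2]
    have p1 : (k : ℝ) + 1 + d + 1 ≠ 0 := by positivity
    have p2 : (d : ℝ) + 2 ≠ 0 := by positivity
    have p3 : (d : ℝ) + 1 ≠ 0 := by positivity
    have p4 : (k : ℝ) + 1 ≠ 0 := by positivity
    generalize ((k + 1 + d).choose k : ℝ) = c at *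
    push_cast
    field_simp
    ring

lemma usd_rec (n : ℕ) :
    ∑ k ∈ Finset.range (n + 1), (((n + 1).choose k : ℝ) ^ 2)⁻¹ =
      (((n : ℝ) + 2) ^ 3 * ∑ k ∈ Finset.range n, ((n.choose k : ℝ) ^ 2)⁻¹
        + (3 * (n : ℝ) ^ 3 + 12 * (n : ℝ) ^ 2 + 18 * (n : ℝ) + 10)) /
        ((4 * (n : ℝ) + 10) * ((n : ℝ) + 1) ^ 2) := by
  have h := usd_telescope n n le_rfl
  rw [Finset.sum_sub_distrib, ← Finset.mul_sum, ← Finset.mul_sum] at h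
  rw [Finset.sum_range_succ, eq_div_iff (by positivity), add_mul]
  have hl : (((n + 1).choose n : ℝ) ^ 2)⁻¹ * ((4 * (n : ℝ) + 10) * ((n : ℝ) + 1) ^ 2)
      = 4 * (n : ℝ) + 10 := by
    rw [Nat.choose_succ_self_right]
    push_cast
    have : (n : ℝ) + 1 ≠ 0 := by positivity
    field_simp
  rw [hl]
  simp only [Nat.choose_self, Nat.cast_one, one_pow, inv_one] at h
  linear_combination h

theorem upside_down_binomials_squared (n : ℕ) (hn : 1 ≤ n) :
    ∑ k ∈ Finset.range n, ((n.choose k : ℝ) ^ 2)⁻¹ =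
      ((Nat.factorial (n + 1) : ℝ) * ((n : ℝ) + 1) ^ 2 /
          (Real.Gamma ((n : ℝ) + 5 / 2) * 4 ^ n)) *
        ∑ j ∈ Finset.range n,
          (3 * (j : ℝ) ^ 3 + 12 * (j : ℝ) ^ 2 + 18 * (j : ℝ) + 10) * 4 ^ j *
              Real.Gamma ((j : ℝ) + 5 / 2) /
            (((j : ℝ) + 1) ^ 2 * (Nat.factorial (j + 1) : ℝ) * ((j : ℝ) + 2) ^ 3) := by
  clear hn
  induction n with
  | zero => simp
  | succ n ih =>
    rw [usd_rec, ih, Finset.sum_range_succ]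
    generalize ∑ j ∈ Finset.range n,
          (3 * (j : ℝ) ^ 3 + 12 * (j : ℝ) ^ 2 + 18 * (j : ℝ) + 10) * 4 ^ j *
              Real.Gamma ((j : ℝ) + 5 / 2) /
            (((j : ℝ) + 1) ^ 2 * (Nat.factorial (j + 1) : ℝ) * ((j : ℝ) + 2) ^ 3) = S
    have hG : Real.Gamma (((n + 1 : ℕ) : ℝ) + 5 / 2)
        = ((n : ℝ) + 5 / 2) * Real.Gamma ((n : ℝ) + 5 / 2) := by
      rw [← Real.Gamma_add_one (by positivity)]
      congr 1
      push_cast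
      ring
    have hg : Real.Gamma ((n : ℝ) + 5 / 2) ≠ 0 := (Real.Gamma_pos_of_pos (by positivity)).ne'
    have hf : (Nat.factorial (n + 1) : ℝ) ≠ 0 := by positivity
    rw [hG, Nat.factorial_succ (n + 1)]
    generalize Real.Gamma ((n : ℝ) + 5 / 2) = g at *
    push_cast
    generalize (Nat.factorial (n + 1) : ℝ) = f at *
    have p1 : (n : ℝ) + 1 ≠ 0 := by positivity
    have p2 : (n : ℝ) + 2 ≠ 0 := by positivity
    have p3 : 4 * (n : ℝ) + 10 ≠ 0 := by positivity
    have p5 : (n : ℝ) + 5 / 2 = (4 * (n : ℝ) + 10) / 4 := by ring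
    have p6 : (n : ℝ) + 1 + 1 = n + 2 := by ring
    rw [p5, p6, pow_succ (4 : ℝ) n]
    have p7 : (4 : ℝ) ^ n ≠ 0 := by positivity
    generalize (4 : ℝ) ^ n = q at *
    generalize hy : 4 * (n : ℝ) + 10 = y at *
    field_simp
end

section
/- Let S_n = ∑_{k=0}^{n-1} (C(n,k))^{-2} as a real number (so S_0 = 0). Then for every natural number n ≥ 0, (4n+10)(n+1)^2 · S_{n+1} − (n+2)^3 · S_n = 3n^3 + 12n^2 + 18n + 10. -/
open Finset

lemma aux_telescope (n m : ℕ) (hm : m ≤ n) :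
    (4 * (n : ℝ) + 10) * ((n : ℝ) + 1) ^ 2 *
        (∑ k ∈ Finset.range m, (((n + 1).choose k : ℝ) ^ 2)⁻¹) -
      ((n : ℝ) + 2) ^ 3 * (∑ k ∈ Finset.range m, ((n.choose k : ℝ) ^ 2)⁻¹) =
      (2 * (m : ℝ) - 3 * n - 6) * ((n : ℝ) + 1 - m) ^ 2 * ((n.choose m : ℝ) ^ 2)⁻¹
        + 3 * ((n : ℝ) + 2) * ((n : ℝ) + 1) ^ 2 := by
  induction m with
  | zero => simp; ring
  | succ k ih =>
    have ih := ih (by omega)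
    rw [Finset.sum_range_succ, Finset.sum_range_succ]
    have h1 : (n.choose k : ℝ) * (n + 1) = ((n + 1).choose k : ℝ) * (n + 1 - k) := by
      have h := congrArg (Nat.cast (R := ℝ)) (Nat.choose_mul_succ_eq n k)
      rw [Nat.cast_mul, Nat.cast_mul, Nat.cast_sub (by omega)] at h
      push_cast at h
      exact h
    have h2 : (n.choose (k + 1) : ℝ) * (k + 1) = (n.choose k : ℝ) * (n - k) := by
      have h := congrArg (Nat.cast (R := ℝ)) (Nat.choose_succ_right_eq n k)
      rw [Nat.cast_mul, Nat.cast_mul, Nat.cast_sub (by omega)] at h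
      push_cast at h
      exact h
    have hc : (n.choose k : ℝ) ≠ 0 := by
      exact_mod_cast (Nat.choose_pos (by omega)).ne'
    have hk : (k : ℝ) + 1 ≤ n := by exact_mod_cast hm
    have hn : (n : ℝ) + 1 ≠ 0 := by positivity
    have hk1 : (k : ℝ) + 1 ≠ 0 := by positivity
    have hnk : (n : ℝ) - k ≠ 0 := by linarith
    have hnk1 : (n : ℝ) + 1 - k ≠ 0 := by linarith
    have e1 : ((n + 1).choose k : ℝ) = n.choose k * (n + 1) / (n + 1 - k) := by
      rw [h1]; field_simp
    have e2 : (n.choose (k + 1) : ℝ) = n.choose k * (n - k) / (k + 1) := by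
      rw [← h2]; field_simp
    have key : (4 * (n : ℝ) + 10) * ((n : ℝ) + 1) ^ 2 * (((n + 1).choose k : ℝ) ^ 2)⁻¹
        - ((n : ℝ) + 2) ^ 3 * ((n.choose k : ℝ) ^ 2)⁻¹
        = (2 * ((k : ℝ) + 1) - 3 * n - 6) * ((n : ℝ) - k) ^ 2 * ((n.choose (k + 1) : ℝ) ^ 2)⁻¹
        - (2 * (k : ℝ) - 3 * n - 6) * ((n : ℝ) + 1 - k) ^ 2 * ((n.choose k : ℝ) ^ 2)⁻¹ := by
      rw [e1, e2]
      field_simp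
      ring
    push_cast
    rw [show (n : ℝ) + 1 - (k + 1) = n - k by ring]
    linear_combination ih + key

theorem upside_down_binomials_squared_recurrence (n : ℕ) :
    (4 * (n : ℝ) + 10) * ((n : ℝ) + 1) ^ 2 *
        (∑ k ∈ Finset.range (n + 1), (((n + 1).choose k : ℝ) ^ 2)⁻¹) -
      ((n : ℝ) + 2) ^ 3 * (∑ k ∈ Finset.range n, ((n.choose k : ℝ) ^ 2)⁻¹) =
      3 * (n : ℝ) ^ 3 + 12 * (n : ℝ) ^ 2 + 18 * (n : ℝ) + 10 := by
  have h := aux_telescope n n le_rfl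
  rw [Nat.choose_self] at h
  rw [Finset.sum_range_succ, Nat.choose_succ_self_right]
  have hn : (n : ℝ) + 1 ≠ 0 := by positivity
  have e : ((n : ℝ) + 1) ^ 2 * ((((n + 1 : ℕ) : ℝ)) ^ 2)⁻¹ = 1 := by
    push_cast
    field_simp
  simp only [Nat.cast_one, one_pow, inv_one] at h
  linear_combination h + (4 * (n : ℝ) + 10) * e
end

section
/- Define G(n,k) = (2k − 3n − 6)(k − n − 1)^2 / (C(n,k))^2 as a real number. Then for all natural numbers n ≥ 1 and all k with 0 ≤ k ≤ n−1, the WZ-certificate identity holds: (4n+10)(n+1)^2 / (C(n+1,k))^2 − (n+2)^3 / (C(n,k))^2 = G(n,k+1) − G(n,k). -/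
open Finset

/-- The WZ certificate function `G(n,k) = (2k − 3n − 6)(k − n − 1)² / C(n,k)²`. -/
noncomputable def wzG (n k : ℕ) : ℝ :=
  (2 * (k : ℝ) - 3 * (n : ℝ) - 6) * ((k : ℝ) - (n : ℝ) - 1) ^ 2 / (n.choose k : ℝ) ^ 2

theorem upside_down_binomials_squared_certificate (n k : ℕ) (hn : 1 ≤ n) (hk : k ≤ n - 1) :
    (4 * (n : ℝ) + 10) * ((n : ℝ) + 1) ^ 2 / (((n + 1).choose k : ℝ) ^ 2) -
        ((n : ℝ) + 2) ^ 3 / ((n.choose k : ℝ) ^ 2) =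
      wzG n (k + 1) - wzG n k := by
  obtain ⟨m, rfl⟩ : ∃ m, n = k + m + 1 := ⟨n - 1 - k, by omega⟩
  have h2 := Nat.choose_succ_right_eq (k + m + 1) k
  have h3 := Nat.choose_mul_succ_eq (k + m + 1) k
  have e1 : k + m + 1 - k = m + 1 := by omega
  have e2 : k + m + 1 + 1 - k = m + 2 := by omega
  rw [e1] at h2
  rw [e2] at h3
  have p : 0 < (k + m + 1).choose k := Nat.choose_pos (by omega)
  have hp : ((k + m + 1).choose k : ℝ) ≠ 0 := by exact_mod_cast p.ne'
  have hk1 : (k : ℝ) + 1 ≠ 0 := by positivity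
  have hm1 : (m : ℝ) + 1 ≠ 0 := by positivity
  have hm2 : (m : ℝ) + 2 ≠ 0 := by positivity
  have hn2 : (k : ℝ) + m + 1 + 1 ≠ 0 := by positivity
  have g2 : ((k + m + 1).choose (k + 1) : ℝ) =
      ((k + m + 1).choose k : ℝ) * (m + 1) / (k + 1) := by
    rw [eq_div_iff hk1]; exact_mod_cast h2
  have g3 : ((k + m + 1 + 1).choose k : ℝ) =
      ((k + m + 1).choose k : ℝ) * (k + m + 1 + 1) / (m + 2) := by
    rw [eq_div_iff hm2]; exact_mod_cast h3.symm
  unfold wzG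
  rw [g2, g3]
  push_cast
  generalize ((k + m + 1).choose k : ℝ) = c at *
  field_simp
  ring
end

section
/- Let q be a real number with q ≠ 0 and q^j ≠ 1 for every integer j ≥ 1. Then for every integer n ≥ 1: ∑_{k=0}^{n-1} q^{−k(k−1)/2} / [n,k]_q = ((q^2;q)_n / (q^2;q^2)_n) · ∑_{i=0}^{n-1} C(i) · (q^2;q^2)_i / ((q^2;q)_i · (q^{i+2} − 1)), where C(i) = (q^{i+1} + q^{3(i+1)} + q^{−i(i−1)/2} + q^{−(i+1)(i−4)/2} − q^{(2+3i−i^2)/2} − q^{−(i+1)(i−2)/2} − 2q^{2(i+1)}) / (q^{i+1} − 1). -/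
open Finset

/-- The q-Pochhammer symbol `(a;q)_m = ∏_{i=0}^{m-1} (1 - a qⁱ)`. -/
noncomputable def qPoch (a q : ℝ) (m : ℕ) : ℝ :=
  ∏ i ∈ Finset.range m, (1 - a * q ^ i)

/-- The Gaussian binomial coefficient `[n,k]_q = ∏_{i=1}^{k} (1 - q^{n-k+i})/(1 - qⁱ)`. -/
noncomputable def qBinom (q : ℝ) (n k : ℕ) : ℝ :=
  ∏ i ∈ Finset.range k, (1 - q ^ (n - k + i + 1)) / (1 - q ^ (i + 1))

/-- The inhomogeneous term `C(i)` in the q-analog of Rockett's identity. -/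
noncomputable def qC (q : ℝ) (i : ℕ) : ℝ :=
  (q ^ (i + 1) + q ^ (3 * (i + 1)) + q ^ (-((i : ℤ) * ((i : ℤ) - 1)) / 2) +
      q ^ (-(((i : ℤ) + 1) * ((i : ℤ) - 4)) / 2) - q ^ ((2 + 3 * (i : ℤ) - (i : ℤ) ^ 2) / 2) -
      q ^ (-(((i : ℤ) + 1) * ((i : ℤ) - 2)) / 2) - 2 * q ^ (2 * (i + 1))) /
    (q ^ (i + 1) - 1)


/-- The power `q^{-k(k-1)/2}`. -/
noncomputable def ff (q : ℝ) (k : ℕ) : ℝ := q ^ (-((k : ℤ) * ((k : ℤ) - 1)) / 2)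

lemma expo (i : ℕ) (a b c : ℤ) (h : a = -((i : ℤ) * ((i : ℤ) - 1)) + 2 * c)
    (hb : b = a / 2) : b = -((i : ℤ) * ((i : ℤ) - 1)) / 2 + c := by
  subst hb h
  omega

lemma ff_succ (q : ℝ) (hq : q ≠ 0) (k : ℕ) : ff q (k + 1) * q ^ k = ff q k := by
  unfold ff
  rw [expo k (-(((k + 1 : ℕ) : ℤ) * (((k + 1 : ℕ) : ℤ) - 1))) _ (-(k : ℤ)) (by push_cast; ring) rfl,
    zpow_add₀ hq, zpow_neg, zpow_natCast]
  have : q ^ k ≠ 0 := pow_ne_zero _ hq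
  field_simp

lemma one_sub_ne (q : ℝ) (hq1 : ∀ j : ℕ, 1 ≤ j → q ^ j ≠ 1) (j : ℕ) : 1 - q ^ (j + 1) ≠ 0 :=
  sub_ne_zero.2 (hq1 (j + 1) (by omega)).symm

lemma qB_ne (q : ℝ) (hq1 : ∀ j : ℕ, 1 ≤ j → q ^ j ≠ 1) (n k : ℕ) : qBinom q n k ≠ 0 := by
  unfold qBinom
  exact prod_ne_zero_iff.2 fun i _ => div_ne_zero (one_sub_ne q hq1 _) (one_sub_ne q hq1 _)

lemma qB_k (q : ℝ) (hq1 : ∀ j : ℕ, 1 ≤ j → q ^ j ≠ 1) (k m : ℕ) :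
    qBinom q (k + m + 1) (k + 1) * (1 - q ^ (k + 1)) =
      qBinom q (k + m + 1) k * (1 - q ^ (m + 1)) := by
  unfold qBinom
  rw [show k + m + 1 - (k + 1) = m by omega, show k + m + 1 - k = m + 1 by omega,
    prod_div_distrib, prod_div_distrib, prod_range_succ', prod_range_succ (fun i => 1 - q ^ (i + 1))]
  have h1 : ∏ i ∈ range k, (1 - q ^ (i + 1)) ≠ 0 :=
    prod_ne_zero_iff.2 fun i _ => one_sub_ne q hq1 _
  have h2 := one_sub_ne q hq1 k
  have h3 : ∏ i ∈ range k, (1 - q ^ (m + (i + 1) + 1)) = ∏ i ∈ range k, (1 - q ^ (m + 1 + i + 1)) :=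
    prod_congr rfl fun i _ => by rw [show m + (i + 1) + 1 = m + 1 + i + 1 by ring]
  rw [h3]
  field_simp

lemma qB_n (q : ℝ) (k m : ℕ) :
    qBinom q (k + m + 1) k * (1 - q ^ (m + 1)) =
      qBinom q (k + m) k * (1 - q ^ (k + m + 1)) := by
  unfold qBinom
  rw [show k + m - k = m by omega, show k + m + 1 - k = m + 1 by omega,
    prod_div_distrib, prod_div_distrib]
  have h3 : (∏ i ∈ range k, (1 - q ^ (m + 1 + i + 1))) * (1 - q ^ (m + 1)) =
      (∏ i ∈ range k, (1 - q ^ (m + i + 1))) * (1 - q ^ (k + m + 1)) := by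
    have h := prod_range_succ' (fun i => 1 - q ^ (m + i + 1)) k
    rw [prod_range_succ] at h
    rw [show k + m + 1 = m + k + 1 by ring, h]
    congr 1
    exact prod_congr rfl fun i _ => by rw [show m + (i + 1) + 1 = m + 1 + i + 1 by ring]
  rw [div_mul_eq_mul_div, h3, div_mul_eq_mul_div]

lemma qB_self (q : ℝ) (hq1 : ∀ j : ℕ, 1 ≤ j → q ^ j ≠ 1) (n : ℕ) : qBinom q n n = 1 := by
  unfold qBinom
  apply prod_eq_one
  intro i _
  rw [show n - n + i + 1 = i + 1 by omega]
  exact div_self (one_sub_ne q hq1 i)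

lemma qC_eq (q : ℝ) (hq : q ≠ 0) (hq1 : ∀ j : ℕ, 1 ≤ j → q ^ j ≠ 1) (i : ℕ) :
    qC q i = -(q ^ (i + 1) * (1 - q ^ (i + 1)) + ff q i * (1 - q)) := by
  unfold qC
  rw [expo i (-(((i : ℤ) + 1) * ((i : ℤ) - 4))) _ ((i + 2 : ℕ) : ℤ) (by push_cast; ring) rfl,
    expo i (2 + 3 * (i : ℤ) - (i : ℤ) ^ 2) _ ((i + 1 : ℕ) : ℤ) (by push_cast; ring) rfl,
    expo i (-(((i : ℤ) + 1) * ((i : ℤ) - 2))) _ ((1 : ℕ) : ℤ) (by push_cast; ring) rfl,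
    zpow_add₀ hq, zpow_add₀ hq, zpow_add₀ hq, zpow_natCast, zpow_natCast, zpow_natCast]
  change (_ + _ + ff q i + ff q i * _ - ff q i * _ - ff q i * _ - _) / _ = _
  rw [div_eq_iff (sub_ne_zero.2 (hq1 (i + 1) (by omega)))]
  ring

lemma tele (q : ℝ) (hq : q ≠ 0) (hq1 : ∀ j : ℕ, 1 ≤ j → q ^ j ≠ 1) (k m : ℕ) :
    (1 - q ^ (2 * (k + m + 1) + 2)) * (ff q k / qBinom q (k + m + 1 + 1) k) -
      (1 - q ^ (k + m + 1 + 2)) * (ff q k / qBinom q (k + m + 1) k) =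
    (-q ^ (k + m + 1 + 1) * (1 - q ^ (m + 1)) * (ff q (k + 1) / qBinom q (k + m + 1) (k + 1))) -
    (-q ^ (k + m + 1 + 1) * (1 - q ^ (m + 2)) * (ff q k / qBinom q (k + m + 1) k)) := by
  have hk := qB_k q hq1 k m
  have hn := qB_n q k (m + 1)
  have b0 := qB_ne q hq1 (k + m + 1) k
  have d1 := one_sub_ne q hq1 k
  have d2 := one_sub_ne q hq1 (m + 1)
  have d3 := one_sub_ne q hq1 m
  have d4 := one_sub_ne q hq1 (k + m + 1)
  rw [← eq_div_iff d1] at hk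
  rw [← eq_div_iff d2] at hn
  rw [← add_assoc] at hn
  rw [hk, hn, ← ff_succ q hq k]
  have e1 : 1 - q ^ (m + 1 + 1) ≠ 0 := d2
  have e2 : 1 - q ^ (k + m + 1 + 1) ≠ 0 := d4
  have e3 : q ^ k ≠ 0 := pow_ne_zero _ hq
  generalize qBinom q (k + m + 1) k = B at *
  generalize ff q (k + 1) = f at *
  field_simp
  ring

lemma recur (q : ℝ) (hq : q ≠ 0) (hq1 : ∀ j : ℕ, 1 ≤ j → q ^ j ≠ 1) (n : ℕ) :
    (1 - q ^ (2 * n + 2)) * ∑ k ∈ range (n + 1), ff q k / qBinom q (n + 1) k =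
      (1 - q ^ (n + 2)) * (∑ k ∈ range n, ff q k / qBinom q n k) - qC q n := by
  have h : ∑ k ∈ range n, ((1 - q ^ (2 * n + 2)) * (ff q k / qBinom q (n + 1) k) -
      (1 - q ^ (n + 2)) * (ff q k / qBinom q n k)) =
      ∑ k ∈ range n, ((-q ^ (n + 1) * (1 - q ^ (n - (k + 1) + 1)) * (ff q (k + 1) / qBinom q n (k + 1))) -
    (-q ^ (n + 1) * (1 - q ^ (n - k + 1)) * (ff q k / qBinom q n k))) := by
    refine sum_congr rfl fun k hk => ?_
    obtain ⟨m, rfl⟩ : ∃ m, n = k + m + 1 := ⟨n - k - 1, by have := mem_range.1 hk; omega⟩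
    rw [show k + m + 1 - (k + 1) + 1 = m + 1 by omega, show k + m + 1 - k + 1 = m + 2 by omega]
    exact tele q hq hq1 k m
  rw [sum_range_sub (fun k => -q ^ (n + 1) * (1 - q ^ (n - k + 1)) * (ff q k / qBinom q n k)),
    sum_sub_distrib, ← mul_sum, ← mul_sum] at h
  rw [sum_range_succ, mul_add, qC_eq q hq hq1]
  have h0 : ff q 0 = 1 := by simp [ff]
  have h0' : qBinom q n 0 = 1 := by simp [qBinom]
  have hn := qB_n q n 0
  have d2 := one_sub_ne q hq1 0
  have d4 := one_sub_ne q hq1 n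
  rw [← eq_div_iff d2, add_zero, qB_self q hq1] at hn
  simp only [qB_self q hq1, h0, h0', Nat.sub_self, Nat.sub_zero] at h
  have h5 : (1 - q ^ (2 * n + 2)) * (ff q n / qBinom q (n + 1) n) =
      (1 + q ^ (n + 1)) * (1 - q) * ff q n := by
    rw [hn]
    field_simp
    ring
  rw [h5]
  linear_combination h

lemma main_aux (q : ℝ) (hq : q ≠ 0) (hq1 : ∀ j : ℕ, 1 ≤ j → q ^ j ≠ 1) (n : ℕ) :
    ∑ k ∈ Finset.range n, ff q k / qBinom q n k =
      (qPoch (q ^ 2) q n / qPoch (q ^ 2) (q ^ 2) n) *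
        ∑ i ∈ Finset.range n,
          qC q i * qPoch (q ^ 2) (q ^ 2) i / (qPoch (q ^ 2) q i * (q ^ (i + 2) - 1)) := by
  induction n with
  | zero => simp
  | succ n ih =>
    have h := recur q hq hq1 n
    have d := one_sub_ne q hq1 (2 * n + 1)
    have d' := one_sub_ne q hq1 (n + 1)
    have e : 1 - q ^ (2 * n + 2) ≠ 0 := d
    have e' : 1 - q ^ (n + 2) ≠ 0 := d'
    have e'' : q ^ (n + 2) - 1 ≠ 0 := sub_ne_zero.2 (hq1 (n + 2) (by omega))
    have p1 : qPoch (q ^ 2) q n ≠ 0 := prod_ne_zero_iff.2 fun i _ => by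
      rw [← pow_add, add_comm]; exact one_sub_ne q hq1 (i + 1)
    have p2 : qPoch (q ^ 2) (q ^ 2) n ≠ 0 := prod_ne_zero_iff.2 fun i _ => by
      rw [← pow_mul, ← pow_add, add_comm]; exact one_sub_ne q hq1 (2 * i + 1)
    have s1 : qPoch (q ^ 2) q (n + 1) = qPoch (q ^ 2) q n * (1 - q ^ (n + 2)) := by
      unfold qPoch; rw [prod_range_succ]; ring
    have s2 : qPoch (q ^ 2) (q ^ 2) (n + 1) = qPoch (q ^ 2) (q ^ 2) n * (1 - q ^ (2 * n + 2)) := by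
      unfold qPoch; rw [prod_range_succ]; ring
    rw [ih, mul_comm, ← eq_div_iff e] at h
    rw [h, s1, s2, sum_range_succ]
    generalize ∑ i ∈ Finset.range n,
          qC q i * qPoch (q ^ 2) (q ^ 2) i / (qPoch (q ^ 2) q i * (q ^ (i + 2) - 1)) = T
    generalize qPoch (q ^ 2) q n = P at *
    generalize qPoch (q ^ 2) (q ^ 2) n = Q at *
    generalize qC q n = c at *
    generalize q ^ (n + 2) = M at *
    generalize q ^ (2 * n + 2) = L at *
    field_simp
    ring

theorem upside_down_q_binomial (q : ℝ) (hq : q ≠ 0) (hq1 : ∀ j : ℕ, 1 ≤ j → q ^ j ≠ 1)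
    (n : ℕ) (hn : 1 ≤ n) :
    ∑ k ∈ Finset.range n, q ^ (-((k : ℤ) * ((k : ℤ) - 1)) / 2) / qBinom q n k =
      (qPoch (q ^ 2) q n / qPoch (q ^ 2) (q ^ 2) n) *
        ∑ i ∈ Finset.range n,
          qC q i * qPoch (q ^ 2) (q ^ 2) i / (qPoch (q ^ 2) q i * (q ^ (i + 2) - 1)) := by
  exact main_aux q hq hq1 n
end

section
/- Let q be a real number with q ≠ 0 and q^j ≠ 1 for every integer j ≥ 1. Define F(n,k) = q^{−k(k−1)/2} / [n,k]_q and G(n,k) = q^{n+1} (1 − q^{n−k+1}) q^{−k(k−1)/2} / [n,k]_q. Then for all natural numbers n ≥ 1 and all k with 0 ≤ k ≤ n−1, the WZ-certificate identity holds: (q^{n+1} − 1)(q^{n+1} + 1) · F(n+1,k) − (q^{n+2} − 1) · F(n,k) = G(n,k+1) − G(n,k). -/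
open Finset

/-- The summand `F(n,k) = q^{-k(k-1)/2} / [n,k]_q`. -/
noncomputable def qF (q : ℝ) (n k : ℕ) : ℝ :=
  q ^ (-((k : ℤ) * ((k : ℤ) - 1)) / 2) / qBinom q n k

/-- The WZ certificate `G(n,k) = q^{n+1}(1 - q^{n-k+1}) q^{-k(k-1)/2} / [n,k]_q`. -/
noncomputable def qG (q : ℝ) (n k : ℕ) : ℝ :=
  q ^ (n + 1) * (1 - q ^ (n - k + 1)) * q ^ (-((k : ℤ) * ((k : ℤ) - 1)) / 2) / qBinom q n k

theorem qProd_shift (q : ℝ) (m k : ℕ) :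
    (∏ i ∈ Finset.range k, (1 - q ^ (m + 1 + i + 1)) / (1 - q ^ (i + 1))) * (1 - q ^ (m + 1)) =
    (∏ i ∈ Finset.range k, (1 - q ^ (m + i + 1)) / (1 - q ^ (i + 1))) * (1 - q ^ (m + k + 1)) := by
  induction k with
  | zero => simp
  | succ k ih =>
    rw [Finset.prod_range_succ, Finset.prod_range_succ]
    have e : m + 1 + k + 1 = m + (k + 1) + 1 := by ring
    rw [e]
    linear_combination ((1 - q ^ (m + (k + 1) + 1)) / (1 - q ^ (k + 1))) * ih

theorem qProd_ne (q : ℝ) (hq1 : ∀ j : ℕ, 1 ≤ j → q ^ j ≠ 1) (m k : ℕ) :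
    (∏ i ∈ Finset.range k, (1 - q ^ (m + i + 1)) / (1 - q ^ (i + 1))) ≠ 0 := by
  refine Finset.prod_ne_zero_iff.2 fun i _ => div_ne_zero ?_ ?_
  · exact sub_ne_zero.2 (hq1 _ (by omega)).symm
  · exact sub_ne_zero.2 (hq1 _ (by omega)).symm

theorem upside_down_q_binomial_certificate (q : ℝ) (hq : q ≠ 0)
    (hq1 : ∀ j : ℕ, 1 ≤ j → q ^ j ≠ 1) (n k : ℕ) (hn : 1 ≤ n) (hk : k ≤ n - 1) :
    (q ^ (n + 1) - 1) * (q ^ (n + 1) + 1) * qF q (n + 1) k - (q ^ (n + 2) - 1) * qF q n k =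
      qG q n (k + 1) - qG q n k := by
  obtain ⟨m, rfl⟩ : ∃ m, n = m + 1 + k := ⟨n - 1 - k, by omega⟩
  have hz : q ^ (-(((k + 1 : ℕ) : ℤ) * (((k + 1 : ℕ) : ℤ) - 1)) / 2)
      = q ^ (-((k : ℤ) * ((k : ℤ) - 1)) / 2) / q ^ k := by
    have e : -(((k + 1 : ℕ) : ℤ) * (((k + 1 : ℕ) : ℤ) - 1)) / 2
        = -((k : ℤ) * ((k : ℤ) - 1)) / 2 - k := by
      have : -(((k + 1 : ℕ) : ℤ) * (((k + 1 : ℕ) : ℤ) - 1))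
        = -((k : ℤ) * ((k : ℤ) - 1)) + (-k) * 2 := by push_cast; ring
      rw [this, Int.add_mul_ediv_right _ _ (by norm_num)]; ring
    rw [e, zpow_sub₀ hq, zpow_natCast]
  have hne : ∀ j : ℕ, 1 - q ^ (j + 1) ≠ 0 := fun j => sub_ne_zero.2 (hq1 _ (by omega)).symm
  have s1 := qProd_shift q (m + 1) k
  have s0 := qProd_shift q m k
  have n1 := qProd_ne q hq1 (m + 1) k
  unfold qF qG qBinom
  rw [hz, Finset.prod_range_succ]
  have e1 : m + 1 + k + 1 - k = m + 1 + 1 := by omega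
  have e2 : m + 1 + k - k = m + 1 := by omega
  have e3 : m + 1 + k - (k + 1) = m := by omega
  rw [e1, e2, e3]
  rw [← eq_div_iff (hne _)] at s1
  have s0' := s0.symm
  rw [← mul_div_assoc (∏ i ∈ Finset.range k, (1 - q ^ (m + i + 1)) / (1 - q ^ (i + 1))), s0', s1]
  generalize (∏ i ∈ Finset.range k, (1 - q ^ (m + 1 + i + 1)) / (1 - q ^ (i + 1))) = B at *
  generalize q ^ (-((k : ℤ) * ((k : ℤ) - 1)) / 2) = Z
  have h1 := hne (m + 1)
  have h2 := hne m
  have h3 := hne k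
  have h4 := hne (m + 1 + k)
  have hk0 : q ^ k ≠ 0 := pow_ne_zero _ hq
  have A : (q ^ (m + 1 + k + 1) - 1) * (q ^ (m + 1 + k + 1) + 1) *
      (Z / (B * (1 - q ^ (m + 1 + k + 1)) / (1 - q ^ (m + 1 + 1))))
      = -(q ^ (m + 1 + k + 1) + 1) * (1 - q ^ (m + 1 + 1)) * (Z / B) := by
    generalize q ^ (m + 1 + k + 1) = x at *
    generalize q ^ (m + 1 + 1) = y at *
    field_simp
    ring
  have C : q ^ (m + 1 + k + 1) * (1 - q ^ (m + 1)) * (Z / q ^ k) /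
      (B * (1 - q ^ (m + 1)) / (1 - q ^ (k + 1)))
      = q ^ (m + 2) * (1 - q ^ (k + 1)) * (Z / B) := by
    have : q ^ (m + 1 + k + 1) = q ^ (m + 2) * q ^ k := by ring
    rw [this]
    generalize q ^ (m + 1) = x at *
    generalize q ^ (k + 1) = y at *
    field_simp
  rw [A, C]
  ring
end

section
/- Let a, n, m be natural numbers with n ≤ a, 1 ≤ m, and m ≤ n+1. Then, as an identity of real numbers: ∑_{k=0}^{m-1} (C(m,k))^{-1} (C(a,n−k))^{-1} = g(m) · ∑_{i=0}^{m-1} C(i) / (g(i) · (i+2) · (a+i−n+2)), where g(m) = (a+m−n+1)! · (a+4)! · (m+1) / (2 · (a+m+3)! · (a−n+2)!) and C(i) = (n + i + i·n + 1) / C(a,n) + (2i + a − n + 3) / C(a, n−i). -/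
open Finset

/-- The closed-form factor `g(m)` in the upside-down Chu-Vandermonde identity. -/
noncomputable def cvG (a n m : ℕ) : ℝ :=
  (Nat.factorial (a + m - n + 1) : ℝ) * (Nat.factorial (a + 4) : ℝ) * ((m : ℝ) + 1) /
    (2 * (Nat.factorial (a + m + 3) : ℝ) * (Nat.factorial (a - n + 2) : ℝ))

/-- The inhomogeneous term `C(i)` in the upside-down Chu-Vandermonde identity. -/
noncomputable def cvC (a n i : ℕ) : ℝ :=
  ((n : ℝ) + (i : ℝ) + (i : ℝ) * (n : ℝ) + 1) / (a.choose n : ℝ) +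
    (2 * (i : ℝ) + (a : ℝ) - (n : ℝ) + 3) / (a.choose (n - i) : ℝ)

lemma cv_inv_up (m k : ℕ) (h : k ≤ m) :
    ((m + 1 : ℕ) : ℝ) * ((m + 1).choose k : ℝ)⁻¹ = ((m : ℝ) + 1 - k) * (m.choose k : ℝ)⁻¹ := by
  have h1 := Nat.choose_mul_succ_eq m k
  have h2 : ((m.choose k : ℕ) : ℝ) * ((m : ℝ) + 1) = ((m + 1).choose k : ℝ) * ((m : ℝ) + 1 - k) := by
    have : ((m + 1 - k : ℕ) : ℝ) = (m : ℝ) + 1 - k := by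
      rw [Nat.cast_sub (by omega)]; push_cast; ring
    rw [← this]; exact_mod_cast h1
  have p1 : (m.choose k : ℝ) ≠ 0 := by exact_mod_cast (Nat.choose_pos h).ne'
  have p2 : ((m + 1).choose k : ℝ) ≠ 0 := by
    exact_mod_cast (Nat.choose_pos (show k ≤ m + 1 by omega)).ne'
  field_simp
  push_cast
  linarith

lemma cv_inv_right (m k : ℕ) (h : k < m) :
    ((m : ℝ) - k) * (m.choose (k + 1) : ℝ)⁻¹ = ((k : ℝ) + 1) * (m.choose k : ℝ)⁻¹ := by
  have h1 := Nat.choose_succ_right_eq m k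
  have h2 : (m.choose (k + 1) : ℝ) * ((k : ℝ) + 1) = (m.choose k : ℝ) * ((m : ℝ) - k) := by
    rw [← Nat.cast_sub h.le]; exact_mod_cast h1
  have p1 : (m.choose k : ℝ) ≠ 0 := by exact_mod_cast (Nat.choose_pos h.le).ne'
  have p2 : (m.choose (k + 1) : ℝ) ≠ 0 := by exact_mod_cast (Nat.choose_pos h).ne'
  field_simp
  linarith

lemma cv_tele (a n m : ℕ) (han : n ≤ a) (hmn : m ≤ n) (j : ℕ) (hj : j ≤ m) :
    ∑ k ∈ Finset.range j,
      (((a : ℝ) + m + 4) * (m + 1) * (((m + 1).choose k : ℝ)⁻¹ * (a.choose (n - k) : ℝ)⁻¹) -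
        ((a : ℝ) + m - n + 2) * (m + 2) * ((m.choose k : ℝ)⁻¹ * (a.choose (n - k) : ℝ)⁻¹)) =
      ((m : ℝ) + 1) * (n + 1) * (a.choose n : ℝ)⁻¹ -
        ((m : ℝ) - j + 1) * (n - j + 1) * ((m.choose j : ℝ)⁻¹ * (a.choose (n - j) : ℝ)⁻¹) := by
  induction j with
  | zero => simp
  | succ j ih =>
    rw [Finset.sum_range_succ, ih (by omega)]
    have e1 := cv_inv_up m j (by omega)
    have e2 := cv_inv_right m j (by omega)
    obtain ⟨d, rfl⟩ : ∃ d, n = j + 1 + d := ⟨n - (j + 1), by omega⟩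
    have e3 := cv_inv_right a d (by omega)
    have s1 : j + 1 + d - j = d + 1 := by omega
    have s2 : j + 1 + d - (j + 1) = d := by omega
    rw [s1, s2]
    push_cast at e1 ⊢
    generalize (a.choose d : ℝ)⁻¹ = A0 at *
    generalize (a.choose (d + 1) : ℝ)⁻¹ = A1 at *
    generalize (m.choose j : ℝ)⁻¹ = M0 at *
    generalize (m.choose (j + 1) : ℝ)⁻¹ = M1 at *
    generalize ((m + 1).choose j : ℝ)⁻¹ = M2 at *
    linear_combination ((a : ℝ) + m + 4) * A1 * e1 + (d + 1) * A0 * e2 - (j + 1) * M0 * e3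

lemma cv_rec (a n m : ℕ) (han : n ≤ a) (hmn : m ≤ n) :
    ((a : ℝ) + m + 4) * (m + 1) *
      ∑ k ∈ Finset.range (m + 1), ((m + 1).choose k : ℝ)⁻¹ * (a.choose (n - k) : ℝ)⁻¹ =
    ((a : ℝ) + m - n + 2) * (m + 2) *
      ∑ k ∈ Finset.range m, (m.choose k : ℝ)⁻¹ * (a.choose (n - k) : ℝ)⁻¹ + cvC a n m := by
  have h := cv_tele a n m han hmn m le_rfl
  rw [Finset.sum_sub_distrib, ← Finset.mul_sum, ← Finset.mul_sum] at h
  rw [Finset.sum_range_succ, cvC, div_eq_mul_inv, div_eq_mul_inv]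
  have e1 := cv_inv_up m m le_rfl
  simp only [Nat.choose_self] at h e1
  push_cast at h e1
  linear_combination h + ((a : ℝ) + m + 4) * (a.choose (n - m) : ℝ)⁻¹ * e1

lemma cvG_pos (a n m : ℕ) : 0 < cvG a n m := by
  unfold cvG; positivity

lemma cvG_succ (a n m : ℕ) (han : n ≤ a) :
    cvG a n (m + 1) * (((a : ℝ) + m + 4) * (m + 1)) =
      cvG a n m * (((a : ℝ) + m - n + 2) * (m + 2)) := by
  obtain ⟨b, rfl⟩ := Nat.exists_eq_add_of_le han
  unfold cvG
  have s1 : n + b + (m + 1) - n + 1 = (b + m + 1) + 1 := by omega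
  have s2 : n + b + m - n + 1 = b + m + 1 := by omega
  have s3 : n + b + (m + 1) + 3 = (n + b + m + 3) + 1 := by omega
  rw [s1, s2, s3, Nat.factorial_succ (b + m + 1), Nat.factorial_succ (n + b + m + 3)]
  have p1 := Nat.cast_ne_zero (R := ℝ).2 (Nat.factorial_ne_zero (n + b + m + 3))
  have p2 := Nat.cast_ne_zero (R := ℝ).2 (Nat.factorial_ne_zero (n + b - n + 2))
  have p3 : (n : ℝ) + b + m + 3 + 1 ≠ 0 := by positivity
  push_cast
  field_simp
  ring

lemma cv_main (a n m : ℕ) (han : n ≤ a) (hmn : m ≤ n + 1) :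
    ∑ k ∈ Finset.range m, (m.choose k : ℝ)⁻¹ * (a.choose (n - k) : ℝ)⁻¹ =
      cvG a n m *
        ∑ i ∈ Finset.range m,
          cvC a n i / (cvG a n i * ((i : ℝ) + 2) * ((a : ℝ) + (i : ℝ) - (n : ℝ) + 2)) := by
  induction m with
  | zero => simp
  | succ m ih =>
    have h := cv_rec a n m han (by omega)
    rw [ih (by omega)] at h
    have g := cvG_succ a n m han
    have hp : ((a : ℝ) + m + 4) * (m + 1) ≠ 0 := by positivity
    have hg := (cvG_pos a n m).ne'
    have hx : (a : ℝ) + m - n + 2 ≠ 0 := by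
      have : (n : ℝ) ≤ a := by exact_mod_cast han
      have : (0 : ℝ) ≤ m := by positivity
      intro; linarith
    have hy : (m : ℝ) + 2 ≠ 0 := by positivity
    apply mul_left_cancel₀ hp
    rw [h, Finset.sum_range_succ]
    have hc : cvG a n m * (((a : ℝ) + m - n + 2) * (m + 2)) *
        (cvC a n m / (cvG a n m * ((m : ℝ) + 2) * ((a : ℝ) + m - n + 2))) = cvC a n m := by
      field_simp
    generalize cvC a n m / (cvG a n m * ((m : ℝ) + 2) * ((a : ℝ) + m - n + 2)) = t at *
    generalize ∑ i ∈ Finset.range m,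
          cvC a n i / (cvG a n i * ((i : ℝ) + 2) * ((a : ℝ) + (i : ℝ) - (n : ℝ) + 2)) = S at *
    linear_combination -(S + t) * g - hc

theorem upside_down_chu_vandermonde (a n m : ℕ) (han : n ≤ a) (hm1 : 1 ≤ m)
    (hmn : m ≤ n + 1) :
    ∑ k ∈ Finset.range m, (m.choose k : ℝ)⁻¹ * (a.choose (n - k) : ℝ)⁻¹ =
      cvG a n m *
        ∑ i ∈ Finset.range m,
          cvC a n i / (cvG a n i * ((i : ℝ) + 2) * ((a : ℝ) + (i : ℝ) - (n : ℝ) + 2)) := by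
  exact cv_main a n m han hmn
end

section
/- Let b, c, n be natural numbers with n ≥ 1, n ≤ b+1, and n ≤ c+1. Then, as an identity of real numbers: ∑_{k=0}^{n-1} (−1)^k (C(n+b, n+k))^{-1} (C(n+c, c+k))^{-1} (C(b+c, b+k))^{-1} = g(n) · ∑_{i=0}^{n-1} C(i) / (g(i) · (2i+2) · (c+i+2) · (b+i+2)), where g(n) = (b+n+1)(c+n+1)(b+c+2)! · n! / ((b+1)(c+1)(b+c+n+2)!) and C(i) = (−1)^i (3bi + 3ci + bc + 3b + 5i^2 + 12i + 3c + 7) · (C(i+b, 2i))^{-1} (C(b+c, b+i))^{-1} − (b+1)(c+1)(i+1) · (C(i+b, i))^{-1} (C(i+c, c))^{-1} (C(b+c, b))^{-1}. -/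
open Finset

/-- The closed-form factor `g(n)` in the upside-down Dixon identity. -/
noncomputable def dixG (b c n : ℕ) : ℝ :=
  ((b : ℝ) + (n : ℝ) + 1) * ((c : ℝ) + (n : ℝ) + 1) * (Nat.factorial (b + c + 2) : ℝ) *
      (Nat.factorial n : ℝ) /
    (((b : ℝ) + 1) * ((c : ℝ) + 1) * (Nat.factorial (b + c + n + 2) : ℝ))

/-- The inhomogeneous term `C(i)` in the upside-down Dixon identity. -/
noncomputable def dixC (b c i : ℕ) : ℝ :=
  (-1 : ℝ) ^ i *
        (3 * (b : ℝ) * (i : ℝ) + 3 * (c : ℝ) * (i : ℝ) + (b : ℝ) * (c : ℝ) + 3 * (b : ℝ) +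
          5 * (i : ℝ) ^ 2 + 12 * (i : ℝ) + 3 * (c : ℝ) + 7) *
        ((i + b).choose (2 * i) : ℝ)⁻¹ * ((b + c).choose (b + i) : ℝ)⁻¹ -
    ((b : ℝ) + 1) * ((c : ℝ) + 1) * ((i : ℝ) + 1) * ((i + b).choose i : ℝ)⁻¹ *
      ((i + c).choose c : ℝ)⁻¹ * ((b + c).choose b : ℝ)⁻¹


/-- The summand. -/
noncomputable def dixF (b c n k : ℕ) : ℝ :=
  (-1 : ℝ) ^ k * ((n + b).choose (n + k) : ℝ)⁻¹ * ((n + c).choose (c + k) : ℝ)⁻¹ *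
          ((b + c).choose (b + k) : ℝ)⁻¹

lemma inv_choose_add (p q : ℕ) : (((p + q).choose p : ℕ) : ℝ)⁻¹ =
    (p.factorial : ℝ) * q.factorial / (p + q).factorial := by
  have h := Nat.add_choose_mul_factorial_mul_factorial p q
  rw [← Nat.choose_symm_add] at h
  have h' : ((p + q).choose p : ℝ) * p.factorial * q.factorial = (p + q).factorial := by
    exact_mod_cast h
  have h0 : ((p + q).choose p : ℝ) ≠ 0 := by
    exact_mod_cast (Nat.choose_pos (Nat.le_add_right p q)).ne'
  rw [← h']
  field_simp

/-- The summand through factorials, with `n = k + m`, `b = k + s`, `c = k + t`. -/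
lemma dixF_eq (k m s t : ℕ) : dixF (k + s) (k + t) (k + m) k =
    (-1 : ℝ) ^ k * ((2 * k + m).factorial * s.factorial / (2 * k + m + s).factorial) *
      ((2 * k + t).factorial * m.factorial / (2 * k + t + m).factorial) *
      ((2 * k + s).factorial * t.factorial / (2 * k + s + t).factorial) := by
  unfold dixF
  rw [← inv_choose_add, ← inv_choose_add, ← inv_choose_add]
  rw [show k + m + (k + s) = 2 * k + m + s by ring, show k + m + k = 2 * k + m by ring,
    show k + m + (k + t) = 2 * k + t + m by ring, show k + t + k = 2 * k + t by ring,
    show k + s + (k + t) = 2 * k + s + t by ring, show k + s + k = 2 * k + s by ring]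

lemma fac_succ (p : ℕ) : ((p + 1).factorial : ℝ) = (p + 1) * p.factorial := by
  rw [Nat.factorial_succ]; push_cast; ring

/-- Recurrence in `n`. -/
lemma dixF_n (b c n k : ℕ) (h1 : k ≤ n) (h2 : k ≤ b) (h3 : k ≤ c) :
    ((b : ℝ) + n + 1) * (c + n + 1) * dixF b c (n + 1) k =
      ((n : ℝ) + 1 + k) * (n + 1 - k) * dixF b c n k := by
  obtain ⟨m, rfl⟩ := Nat.exists_eq_add_of_le h1
  obtain ⟨s, rfl⟩ := Nat.exists_eq_add_of_le h2
  obtain ⟨t, rfl⟩ := Nat.exists_eq_add_of_le h3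
  rw [dixF_eq, show k + m + 1 = k + (m + 1) by ring, dixF_eq,
    show 2 * k + (m + 1) + s = (2 * k + m + s) + 1 by ring,
    show 2 * k + t + (m + 1) = (2 * k + t + m) + 1 by ring,
    show 2 * k + (m + 1) = (2 * k + m) + 1 by ring]
  simp only [fac_succ]
  have e1 : ((2 * k + m + s : ℕ) : ℝ) + 1 ≠ 0 := by positivity
  have e2 : ((2 * k + t + m : ℕ) : ℝ) + 1 ≠ 0 := by positivity
  push_cast at e1 e2 ⊢
  field_simp
  ring

/-- Recurrence in `k`. -/
lemma dixF_k (b c n k : ℕ) (h1 : k + 1 ≤ n) (h2 : k + 1 ≤ b) (h3 : k + 1 ≤ c) :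
    ((b : ℝ) - k) * (c - k) * (n - k) * dixF b c n (k + 1) =
      -(((n : ℝ) + k + 1) * (b + k + 1) * (c + k + 1) * dixF b c n k) := by
  obtain ⟨m, rfl⟩ := Nat.exists_eq_add_of_le h1
  obtain ⟨s, rfl⟩ := Nat.exists_eq_add_of_le h2
  obtain ⟨t, rfl⟩ := Nat.exists_eq_add_of_le h3
  rw [dixF_eq, show k + 1 + m = k + (m + 1) by ring, show k + 1 + s = k + (s + 1) by ring,
    show k + 1 + t = k + (t + 1) by ring, dixF_eq,
    show 2 * k + (m + 1) + (s + 1) = 2 * (k + 1) + m + s by ring,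
    show 2 * k + (t + 1) + (m + 1) = 2 * (k + 1) + t + m by ring,
    show 2 * k + (s + 1) + (t + 1) = 2 * (k + 1) + s + t by ring,
    show 2 * (k + 1) + m = (2 * k + (m + 1)) + 1 by ring,
    show 2 * (k + 1) + s = (2 * k + (s + 1)) + 1 by ring,
    show 2 * (k + 1) + t = (2 * k + (t + 1)) + 1 by ring]
  rw [fac_succ (2 * k + (m + 1)), fac_succ (2 * k + (s + 1)), fac_succ (2 * k + (t + 1)),
    fac_succ m, fac_succ s, fac_succ t, pow_succ]
  push_cast
  ring

/-- Telescoped sum. -/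
lemma dix_tele (b c n : ℕ) (hb : n ≤ b) (hc : n ≤ c) (N : ℕ) (hN : N ≤ n) :
    ∑ k ∈ Finset.range N,
      (2 * ((b : ℝ) + n + 1) * (c + n + 1) * (b + c + n + 3) * dixF b c (n + 1) k -
        2 * ((b : ℝ) + n + 2) * (c + n + 2) * (n + 1) * dixF b c n k) =
    ((n : ℝ) - N + 1) * (b - N + 1) * (c - N + 1) * dixF b c n N -
      ((n : ℝ) + 1) * (b + 1) * (c + 1) * dixF b c n 0 := by
  induction N with
  | zero => simp
  | succ N ih =>
    rw [Finset.sum_range_succ, ih (by omega)]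
    have h1 := dixF_n b c n N (by omega) (by omega) (by omega)
    have h2 := dixF_k b c n N (by omega) (by omega) (by omega)
    push_cast
    linear_combination 2 * ((b : ℝ) + c + n + 3) * h1 - h2

lemma dixC_eq (b c n : ℕ) (hb : n ≤ b) (hc : n ≤ c) : dixC b c n =
    (3 * (b : ℝ) * n + 3 * c * n + b * c + 3 * b + 5 * (n : ℝ) ^ 2 + 12 * n + 3 * c + 7) *
      dixF b c n n - ((b : ℝ) + 1) * (c + 1) * (n + 1) * dixF b c n 0 := by
  unfold dixC dixF
  rw [show n + n = 2 * n by ring, show c + n = n + c by ring]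
  simp
  ring

lemma dix_rec (b c n : ℕ) (hb : n ≤ b) (hc : n ≤ c) :
    2 * ((b : ℝ) + n + 1) * (c + n + 1) * (b + c + n + 3) *
        ∑ k ∈ Finset.range (n + 1), dixF b c (n + 1) k =
      2 * ((b : ℝ) + n + 2) * (c + n + 2) * (n + 1) * ∑ k ∈ Finset.range n, dixF b c n k +
        dixC b c n := by
  have h := dix_tele b c n hb hc n le_rfl
  rw [Finset.sum_sub_distrib, ← Finset.mul_sum, ← Finset.mul_sum] at h
  rw [Finset.sum_range_succ, dixC_eq b c n hb hc]
  have h1 := dixF_n b c n n le_rfl hb hc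
  linear_combination h + 2 * ((b : ℝ) + c + n + 3) * h1

lemma dixG_pos (b c n : ℕ) : 0 < dixG b c n := by unfold dixG; positivity

lemma dixG_rec (b c n : ℕ) : ((b : ℝ) + n + 1) * (c + n + 1) * (b + c + n + 3) * dixG b c (n + 1) =
    ((b : ℝ) + n + 2) * (c + n + 2) * (n + 1) * dixG b c n := by
  unfold dixG
  rw [show b + c + (n + 1) + 2 = (b + c + n + 2) + 1 by ring, fac_succ (b + c + n + 2), fac_succ n]
  have e : ((b + c + n + 2 : ℕ) : ℝ) + 1 ≠ 0 := by positivity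
  push_cast at e ⊢
  field_simp
  ring

lemma dix_main (b c n : ℕ) (hnb : n ≤ b + 1) (hnc : n ≤ c + 1) :
    ∑ k ∈ Finset.range n, dixF b c n k = dixG b c n *
        ∑ i ∈ Finset.range n,
          dixC b c i /
            (dixG b c i * (2 * (i : ℝ) + 2) * ((c : ℝ) + (i : ℝ) + 2) * ((b : ℝ) + (i : ℝ) + 2)) := by
  induction n with
  | zero => simp
  | succ n ih =>
    have h := dix_rec b c n (by omega) (by omega)
    rw [ih (by omega) (by omega)] at h
    have hg := dixG_rec b c n
    have hp := (dixG_pos b c n).ne'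
    rw [Finset.sum_range_succ (fun i : ℕ => dixC b c i / (dixG b c i * (2 * (i : ℝ) + 2) * ((c : ℝ) + (i : ℝ) + 2) * ((b : ℝ) + (i : ℝ) + 2))) n]
    set T := ∑ i ∈ Finset.range n,
          dixC b c i /
            (dixG b c i * (2 * (i : ℝ) + 2) * ((c : ℝ) + (i : ℝ) + 2) * ((b : ℝ) + (i : ℝ) + 2))
    have e : 2 * ((b : ℝ) + n + 1) * (c + n + 1) * (b + c + n + 3) ≠ 0 := by positivity
    apply mul_left_cancel₀ e
    have hx : 2 * ((b : ℝ) + n + 2) * (c + n + 2) * (n + 1) * dixG b c n *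
        (dixC b c n / (dixG b c n * (2 * (n : ℝ) + 2) * ((c : ℝ) + n + 2) * ((b : ℝ) + n + 2)))
        = dixC b c n := by
      have e1 : (b : ℝ) + n + 2 ≠ 0 := by positivity
      have e2 : (c : ℝ) + n + 2 ≠ 0 := by positivity
      have e3 : 2 * (n : ℝ) + 2 ≠ 0 := by positivity
      field_simp
    rw [h]
    linear_combination -2 * (T + dixC b c n / (dixG b c n * (2 * (n : ℝ) + 2) * ((c : ℝ) + n + 2) * ((b : ℝ) + n + 2))) * hg - hx

theorem upside_down_dixon (b c n : ℕ) (hn : 1 ≤ n) (hnb : n ≤ b + 1) (hnc : n ≤ c + 1) :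
    ∑ k ∈ Finset.range n,
        (-1 : ℝ) ^ k * ((n + b).choose (n + k) : ℝ)⁻¹ * ((n + c).choose (c + k) : ℝ)⁻¹ *
          ((b + c).choose (b + k) : ℝ)⁻¹ =
      dixG b c n *
        ∑ i ∈ Finset.range n,
          dixC b c i /
            (dixG b c i * (2 * (i : ℝ) + 2) * ((c : ℝ) + (i : ℝ) + 2) * ((b : ℝ) + (i : ℝ) + 2)) := by
  exact dix_main b c n hnb hnc
end

section
/- Let S_n = ∑_{k=0}^{n-1} (C(n,k))^{-2} as a real number. Then for every natural number n ≥ 1: 2·S_n = ((n+1)^3 / (2n^3 + 3n^2)) · S_{n−1} + (3n^3 + 3n^2 + 3n + 1) / (2n^3 + 3n^2). -/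
open Finset

lemma step_aux (m k : ℕ) (hk : k < m) :
    2 * ((m : ℝ) + 1) ^ 2 * (2 * ((m : ℝ) + 1) + 3) * (((m + 1).choose k : ℝ) ^ 2)⁻¹
      - ((m : ℝ) + 2) ^ 3 * ((m.choose k : ℝ) ^ 2)⁻¹ =
    (fun k : ℕ => ((m : ℝ) + 1 - k) ^ 2 * (2 * k - 3 * m - 6) * ((m.choose k : ℝ) ^ 2)⁻¹) (k + 1)
    - (fun k : ℕ => ((m : ℝ) + 1 - k) ^ 2 * (2 * k - 3 * m - 6) * ((m.choose k : ℝ) ^ 2)⁻¹) k := by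
  obtain ⟨d, rfl⟩ : ∃ d, m = k + 1 + d := ⟨m - (k + 1), by omega⟩
  have h1 := Nat.choose_succ_right_eq (k + 1 + d) k
  have h2 := Nat.choose_mul_succ_eq (k + 1 + d) k
  rw [show k + 1 + d - k = d + 1 by omega] at h1
  rw [show k + 1 + d + 1 - k = d + 2 by omega] at h2
  have p0 : ((k + 1 + d).choose k : ℝ) ≠ 0 := by
    exact_mod_cast (Nat.choose_pos (by omega)).ne'
  have e1 : ((k + 1 + d).choose (k + 1) : ℝ) = (k + 1 + d).choose k * (d + 1) / (k + 1) := by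
    rw [eq_div_iff (by positivity)]; exact_mod_cast h1
  have e2 : ((k + 1 + d + 1).choose k : ℝ) = (k + 1 + d).choose k * (k + 1 + d + 1) / (d + 2) := by
    rw [eq_div_iff (by positivity)]; exact_mod_cast h2.symm
  simp only [e1, e2]
  generalize ((k + 1 + d).choose k : ℝ) = c at *
  have q1 : (k : ℝ) + 1 ≠ 0 := by positivity
  have q2 : (d : ℝ) + 1 ≠ 0 := by positivity
  have q3 : (d : ℝ) + 2 ≠ 0 := by positivity
  have q4 : (k : ℝ) + 1 + d + 1 ≠ 0 := by positivity
  push_cast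
  field_simp
  ring

theorem upside_down_binomials_squared_remark (n : ℕ) (hn : 1 ≤ n) :
    2 * (∑ k ∈ Finset.range n, ((n.choose k : ℝ) ^ 2)⁻¹) =
      ((n : ℝ) + 1) ^ 3 / (2 * (n : ℝ) ^ 3 + 3 * (n : ℝ) ^ 2) *
          (∑ k ∈ Finset.range (n - 1), (((n - 1).choose k : ℝ) ^ 2)⁻¹) +
        (3 * (n : ℝ) ^ 3 + 3 * (n : ℝ) ^ 2 + 3 * (n : ℝ) + 1) /
          (2 * (n : ℝ) ^ 3 + 3 * (n : ℝ) ^ 2) := by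
  obtain ⟨m, rfl⟩ : ∃ m, n = m + 1 := ⟨n - 1, by omega⟩
  have h := Finset.sum_congr rfl (fun k hk => step_aux m k (Finset.mem_range.mp hk))
  replace h := h.trans (Finset.sum_range_sub
    (fun k : ℕ => ((m : ℝ) + 1 - k) ^ 2 * (2 * k - 3 * m - 6) * ((m.choose k : ℝ) ^ 2)⁻¹) m)
  rw [Finset.sum_sub_distrib, ← Finset.mul_sum, ← Finset.mul_sum] at h
  simp only [Nat.choose_self, Nat.choose_zero_right] at h
  rw [Finset.sum_range_succ, Nat.add_sub_cancel, Nat.choose_succ_self_right]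
  generalize ∑ k ∈ Finset.range m, (((m + 1).choose k : ℝ) ^ 2)⁻¹ = A at *
  generalize ∑ k ∈ Finset.range m, ((m.choose k : ℝ) ^ 2)⁻¹ = B at *
  push_cast at *
  have q : (m : ℝ) + 1 ≠ 0 := by positivity
  have q2 : 2 * ((m : ℝ) + 1) ^ 3 + 3 * ((m : ℝ) + 1) ^ 2 ≠ 0 := by positivity
  rw [div_mul_eq_mul_div, ← add_div, eq_div_iff q2]
  have q3 : (((m : ℝ) + 1) ^ 2)⁻¹ * ((m : ℝ) + 1) ^ 2 = 1 := inv_mul_cancel₀ (by positivity)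
  norm_num at h
  linear_combination h + 2 * (2 * (m + 1) + 3) * q3
end

section
/- The sequence of real numbers n ↦ ∑_{k=0}^{n} (C(n,k))^{-2} converges to 2 as n tends to infinity. -/
open Finset Filter

theorem le_choose_inner (n k : ℕ) (h : k + 1 < n) : n ≤ n.choose (k + 1) := by
  induction n with
  | zero => omega
  | succ n ih =>
    rcases Nat.lt_or_ge (k + 1) n with h1 | h1
    · have h2 := ih h1
      have h3 : 0 < n.choose k := Nat.choose_pos (by omega)
      rw [Nat.choose_succ_succ']
      omega
    · have h2 : n = k + 1 := by omega
      subst h2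
      rw [Nat.choose_succ_self_right]

theorem sum_inv_choose_sq_tendsto_two :
    Filter.Tendsto (fun n : ℕ => ∑ k ∈ Finset.range (n + 1), ((n.choose k : ℝ) ^ 2)⁻¹)
      Filter.atTop (nhds 2) := by
  rw [← tendsto_add_atTop_iff_nat 1]
  have key : ∀ m : ℕ, ∑ k ∈ Finset.range (m + 1 + 1), (((m + 1).choose k : ℝ) ^ 2)⁻¹
      = 2 + ∑ k ∈ Finset.range m, (((m + 1).choose (k + 1) : ℝ) ^ 2)⁻¹ := by
    intro m
    rw [Finset.sum_range_succ, Finset.sum_range_succ']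
    simp only [Nat.choose_self, Nat.choose_zero_right]
    norm_num
    ring
  have hb : ∀ m : ℕ, ∑ k ∈ Finset.range m, (((m + 1).choose (k + 1) : ℝ) ^ 2)⁻¹
      ≤ 1 / ((m : ℝ) + 1) := by
    intro m
    have h1 : ∀ k ∈ Finset.range m, (((m + 1).choose (k + 1) : ℝ) ^ 2)⁻¹
        ≤ (((m : ℝ) + 1) ^ 2)⁻¹ := by
      intro k hk
      have h2 := le_choose_inner (m + 1) k (by have := Finset.mem_range.mp hk; omega)
      have h3 : (m : ℝ) + 1 ≤ ((m + 1).choose (k + 1) : ℝ) := by exact_mod_cast h2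
      gcongr
    refine (Finset.sum_le_sum h1).trans ?_
    rw [Finset.sum_const, Finset.card_range, nsmul_eq_mul, ← div_eq_mul_inv,
      div_le_div_iff₀ (by positivity) (by positivity)]
    nlinarith [(Nat.cast_nonneg m : (0 : ℝ) ≤ m)]
  have h0 : Tendsto (fun m : ℕ => ∑ k ∈ Finset.range m, (((m + 1).choose (k + 1) : ℝ) ^ 2)⁻¹)
      atTop (nhds 0) :=
    squeeze_zero (fun m => Finset.sum_nonneg fun k _ => by positivity) hb
      tendsto_one_div_add_atTop_nhds_zero_nat
  simp only [key]
  simpa using h0.const_add 2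
end

section
/- Let x, y be real numbers with x ≠ 0, y ≠ 0, and x + y ≠ 0. Then for every natural number n: ∑_{k=0}^{n} (C(n,k))^{-1} x^k y^{n−k} = x^n + (xy/(x+y))^n (n+1) ∑_{j=0}^{n-1} ((j+1) y^{j+2} + y x^{j+1})(x+y)^j / ((xy)^{j+1} (j+1)(j+2)). -/
open Finset

lemma inv_choose_aux (n k : ℕ) (hk : k ≤ n) :
    ((n : ℝ) + 1) * (((n + 1).choose k : ℝ)⁻¹ + ((n + 1).choose (k + 1) : ℝ)⁻¹) =
      ((n : ℝ) + 2) * (n.choose k : ℝ)⁻¹ := by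
  obtain ⟨m, rfl⟩ := Nat.exists_eq_add_of_le hk
  have h0 : ((k + m).choose k : ℝ) ≠ 0 := by
    exact_mod_cast (Nat.choose_pos hk).ne'
  have h1 : ((k + m + 1).choose k : ℝ) ≠ 0 := by
    exact_mod_cast (Nat.choose_pos (by omega)).ne'
  have h2 : ((k + m + 1).choose (k + 1) : ℝ) ≠ 0 := by
    exact_mod_cast (Nat.choose_pos (by omega)).ne'
  have e1 : ((k : ℝ) + m + 1) * ((k + m).choose k : ℝ) =
      ((k + m + 1).choose (k + 1) : ℝ) * ((k : ℝ) + 1) := by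
    exact_mod_cast Nat.add_one_mul_choose_eq (k + m) k
  have e2 : ((k + m).choose k : ℝ) * ((k : ℝ) + m + 1) =
      ((k + m + 1).choose k : ℝ) * ((m : ℝ) + 1) := by
    have := Nat.choose_mul_succ_eq (k + m) k
    rw [show k + m + 1 - k = m + 1 by omega] at this
    exact_mod_cast this
  have f1 : ((k : ℝ) + m + 1) * ((k + m + 1).choose (k + 1) : ℝ)⁻¹ =
      ((k : ℝ) + 1) * ((k + m).choose k : ℝ)⁻¹ := by
    field_simp
    linarith
  have f2 : ((k : ℝ) + m + 1) * ((k + m + 1).choose k : ℝ)⁻¹ =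
      ((m : ℝ) + 1) * ((k + m).choose k : ℝ)⁻¹ := by
    field_simp
    linarith
  push_cast
  linear_combination f1 + f2

lemma inv_choose_rec (x y : ℝ) (n : ℕ) :
    (x + y) * ((n : ℝ) + 1) *
      ∑ k ∈ Finset.range (n + 1 + 1), ((n + 1).choose k : ℝ)⁻¹ * x ^ k * y ^ (n + 1 - k) =
    x * y * ((n : ℝ) + 2) * ∑ k ∈ Finset.range (n + 1), (n.choose k : ℝ)⁻¹ * x ^ k * y ^ (n - k)
      + ((n : ℝ) + 1) * (x ^ (n + 2) + y ^ (n + 2)) := by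
  have a := Finset.sum_range_succ
    (fun k => ((n + 1).choose k : ℝ)⁻¹ * x ^ k * y ^ (n + 1 - k)) (n + 1)
  have b := Finset.sum_range_succ'
    (fun k => ((n + 1).choose k : ℝ)⁻¹ * x ^ k * y ^ (n + 1 - k)) (n + 1)
  simp only [Nat.choose_self, Nat.choose_zero_right, Nat.cast_one, inv_one, one_mul, Nat.sub_self,
    pow_zero, mul_one, Nat.sub_zero, Nat.add_sub_add_right] at a b
  have c : x * ((n : ℝ) + 1) * ∑ k ∈ Finset.range (n + 1),
        ((n + 1).choose k : ℝ)⁻¹ * x ^ k * y ^ (n + 1 - k) +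
      y * ((n : ℝ) + 1) * ∑ k ∈ Finset.range (n + 1),
        ((n + 1).choose (k + 1) : ℝ)⁻¹ * x ^ (k + 1) * y ^ (n - k) =
      x * y * ((n : ℝ) + 2) *
        ∑ k ∈ Finset.range (n + 1), (n.choose k : ℝ)⁻¹ * x ^ k * y ^ (n - k) := by
    rw [Finset.mul_sum, Finset.mul_sum, Finset.mul_sum, ← Finset.sum_add_distrib]
    refine Finset.sum_congr rfl fun k hk => ?_
    have hk : k ≤ n := by simpa [Nat.lt_succ_iff] using hk
    rw [show n + 1 - k = (n - k) + 1 by omega]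
    linear_combination x * y * x ^ k * y ^ (n - k) * inv_choose_aux n k hk
  linear_combination x * ((n : ℝ) + 1) * a + y * ((n : ℝ) + 1) * b + c

theorem upside_down_binomial_two_variables (x y : ℝ) (hx : x ≠ 0) (hy : y ≠ 0)
    (hxy : x + y ≠ 0) (n : ℕ) :
    ∑ k ∈ Finset.range (n + 1), (n.choose k : ℝ)⁻¹ * x ^ k * y ^ (n - k) =
      x ^ n +
        (x * y / (x + y)) ^ n * ((n : ℝ) + 1) *
          ∑ j ∈ Finset.range n,
            (((j : ℝ) + 1) * y ^ (j + 2) + y * x ^ (j + 1)) * (x + y) ^ j /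
              ((x * y) ^ (j + 1) * ((j : ℝ) + 1) * ((j : ℝ) + 2)) := by
  induction n with
  | zero => simp
  | succ n ih =>
    have r := inv_choose_rec x y n
    rw [ih] at r
    have hn : (n : ℝ) + 1 ≠ 0 := by positivity
    have hn2 : (n : ℝ) + 2 ≠ 0 := by positivity
    apply mul_left_cancel₀ (mul_ne_zero hxy hn)
    rw [r, Finset.sum_range_succ]
    generalize (∑ j ∈ Finset.range n,
            (((j : ℝ) + 1) * y ^ (j + 2) + y * x ^ (j + 1)) * (x + y) ^ j /
              ((x * y) ^ (j + 1) * ((j : ℝ) + 1) * ((j : ℝ) + 2))) = T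
    have t : (x + y) * (x * y / (x + y)) ^ (n + 1) *
        ((((n : ℝ) + 1) * y ^ (n + 2) + y * x ^ (n + 1)) * (x + y) ^ n /
              ((x * y) ^ (n + 1) * ((n : ℝ) + 1) * ((n : ℝ) + 2))) * (((n : ℝ) + 1) * ((n : ℝ) + 2))
        = ((n : ℝ) + 1) * y ^ (n + 2) + y * x ^ (n + 1) := by
      rw [div_pow]
      have : (x * y) ^ (n + 1) ≠ 0 := pow_ne_zero _ (mul_ne_zero hx hy)
      generalize (x * y) ^ (n + 1) = P at *
      field_simp
      ring
    have s : (x + y) * (x * y / (x + y)) ^ (n + 1) = x * y * (x * y / (x + y)) ^ n := by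
      rw [pow_succ]
      field_simp
    push_cast
    linear_combination (-1 : ℝ) * t - ((n : ℝ) + 1) * ((n : ℝ) + 2) * T * s
end

section
/- Let x, y be real numbers and let S_n = ∑_{k=0}^{n-1} (C(n,k))^{-1} x^k y^{n−k} as a real number (so S_0 = 0). Then for every natural number n ≥ 0: (x+y)(n+1) · S_{n+1} − (n+2) x y · S_n = (n+1) y^{n+2} + y x^{n+1}. -/
open Finset

lemma aux_coeff (n k : ℕ) (h : k < n) :
    ((n : ℝ) + 1) * (((n + 1).choose k : ℝ)⁻¹ + ((n + 1).choose (k + 1) : ℝ)⁻¹) =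
      ((n : ℝ) + 2) * (n.choose k : ℝ)⁻¹ := by
  have h1 : ((n : ℝ) + 1) * n.choose k = (n + 1).choose (k + 1) * ((k : ℝ) + 1) := by
    exact_mod_cast Nat.add_one_mul_choose_eq n k
  have h2 : (n.choose k : ℝ) * ((n : ℝ) + 1) = (n + 1).choose k * ((n : ℝ) + 1 - k) := by
    have := congrArg (Nat.cast : ℕ → ℝ) (Nat.choose_mul_succ_eq n k)
    rw [Nat.cast_mul, Nat.cast_mul, Nat.cast_sub (by omega)] at this
    push_cast at this
    exact this
  have p0 : (n.choose k : ℝ) ≠ 0 := by exact_mod_cast (Nat.choose_pos (by omega)).ne'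
  have p1 : ((n + 1).choose k : ℝ) ≠ 0 := by exact_mod_cast (Nat.choose_pos (by omega)).ne'
  have p2 : ((n + 1).choose (k + 1) : ℝ) ≠ 0 := by
    exact_mod_cast (Nat.choose_pos (by omega)).ne'
  have e1 : ((n : ℝ) + 1) * ((n + 1).choose (k + 1) : ℝ)⁻¹ = (k + 1) * (n.choose k : ℝ)⁻¹ := by
    field_simp
    linarith
  have e2 : ((n : ℝ) + 1) * ((n + 1).choose k : ℝ)⁻¹ = (n + 1 - k) * (n.choose k : ℝ)⁻¹ := by
    field_simp
    linarith
  rw [mul_add, e1, e2]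
  ring

theorem upside_down_binomial_two_variables_recurrence (x y : ℝ) (n : ℕ) :
    (x + y) * ((n : ℝ) + 1) *
        (∑ k ∈ Finset.range (n + 1), ((n + 1).choose k : ℝ)⁻¹ * x ^ k * y ^ (n + 1 - k)) -
      ((n : ℝ) + 2) * x * y *
        (∑ k ∈ Finset.range n, (n.choose k : ℝ)⁻¹ * x ^ k * y ^ (n - k)) =
      ((n : ℝ) + 1) * y ^ (n + 2) + y * x ^ (n + 1) := by
  set S := ∑ k ∈ Finset.range (n + 1), ((n + 1).choose k : ℝ)⁻¹ * x ^ k * y ^ (n + 1 - k) with hS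
  have hn : (n : ℝ) + 1 ≠ 0 := by positivity
  have A : S = (∑ k ∈ Finset.range n, ((n + 1).choose k : ℝ)⁻¹ * x ^ k * y ^ (n + 1 - k))
      + ((n : ℝ) + 1)⁻¹ * x ^ n * y := by
    rw [hS, Finset.sum_range_succ]
    simp
  have B : S = (∑ k ∈ Finset.range n,
      ((n + 1).choose (k + 1) : ℝ)⁻¹ * x ^ (k + 1) * y ^ (n - k)) + y ^ (n + 1) := by
    rw [hS, Finset.sum_range_succ']
    simp
  have C : ((n : ℝ) + 1) * (x * (∑ k ∈ Finset.range n,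
        ((n + 1).choose k : ℝ)⁻¹ * x ^ k * y ^ (n + 1 - k))
      + y * (∑ k ∈ Finset.range n,
        ((n + 1).choose (k + 1) : ℝ)⁻¹ * x ^ (k + 1) * y ^ (n - k)))
      = ((n : ℝ) + 2) * x * y *
        (∑ k ∈ Finset.range n, (n.choose k : ℝ)⁻¹ * x ^ k * y ^ (n - k)) := by
    simp only [Finset.mul_sum, ← Finset.sum_add_distrib]
    refine Finset.sum_congr rfl fun k hk => ?_
    have hk' := Finset.mem_range.mp hk
    have e : n + 1 - k = (n - k) + 1 := by omega
    rw [e]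
    linear_combination x ^ (k + 1) * y ^ (n - k + 1) * aux_coeff n k hk'
  have D : ((n : ℝ) + 1) * ((n : ℝ) + 1)⁻¹ = 1 := mul_inv_cancel₀ hn
  linear_combination (n + 1) * x * A + (n + 1) * y * B + C + x ^ (n + 1) * y * D
end

section
/- For every natural number n: ∑_{k=0}^{n} (C(n,k))^{-1} = ((n+1)/2^n) · ∑_{j=0}^{n} 2^j/(j+1), as an identity of real numbers (Rockett's identity). -/
open Finset

theorem rockett_pair (n k : ℕ) (h : k ≤ n) :
    ((n + 1).choose k : ℝ)⁻¹ + ((n + 1).choose (k + 1) : ℝ)⁻¹ =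
      ((n : ℝ) + 2) / (n + 1) * (n.choose k : ℝ)⁻¹ := by
  obtain ⟨m, rfl⟩ := Nat.exists_eq_add_of_le h
  have h1 := Nat.add_one_mul_choose_eq (k + m) k
  have h2 := Nat.choose_mul_succ_eq (k + m) k
  rw [show k + m + 1 - k = m + 1 by omega] at h2
  have p0 : ((k + m).choose k : ℝ) ≠ 0 := by
    exact_mod_cast (Nat.choose_pos (by omega)).ne'
  have p1 : ((k + m + 1).choose k : ℝ) ≠ 0 := by
    exact_mod_cast (Nat.choose_pos (by omega)).ne'
  have p2 : ((k + m + 1).choose (k + 1) : ℝ) ≠ 0 := by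
    exact_mod_cast (Nat.choose_pos (by omega)).ne'
  have h1' : ((k : ℝ) + m + 1) * ((k + m).choose k : ℝ)
      = ((k + m + 1).choose (k + 1) : ℝ) * (k + 1) := by exact_mod_cast h1
  have h2' : ((k + m).choose k : ℝ) * ((k : ℝ) + m + 1)
      = ((k + m + 1).choose k : ℝ) * (m + 1) := by exact_mod_cast h2
  have q : (k : ℝ) + m + 1 ≠ 0 := by positivity
  have e1 : ((k + m + 1).choose (k + 1) : ℝ)⁻¹
      = (k + 1) / (((k : ℝ) + m + 1) * ((k + m).choose k : ℝ)) := by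
    rw [inv_eq_one_div, div_eq_div_iff p2 (mul_ne_zero q p0)]; linarith
  have e2 : ((k + m + 1).choose k : ℝ)⁻¹
      = (m + 1) / (((k : ℝ) + m + 1) * ((k + m).choose k : ℝ)) := by
    rw [inv_eq_one_div, div_eq_div_iff p1 (mul_ne_zero q p0)]; linarith
  rw [e1, e2]
  push_cast
  field_simp
  ring

theorem rockett_rec (n : ℕ) :
    2 * ∑ k ∈ Finset.range (n + 1 + 1), ((n + 1).choose k : ℝ)⁻¹ =
      2 + ((n : ℝ) + 2) / (n + 1) * ∑ k ∈ Finset.range (n + 1), (n.choose k : ℝ)⁻¹ := by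
  have h : ∑ k ∈ Finset.range (n + 1),
      (((n + 1).choose k : ℝ)⁻¹ + ((n + 1).choose (k + 1) : ℝ)⁻¹) =
      ((n : ℝ) + 2) / (n + 1) * ∑ k ∈ Finset.range (n + 1), (n.choose k : ℝ)⁻¹ := by
    rw [Finset.mul_sum]
    refine Finset.sum_congr rfl fun k hk => rockett_pair n k ?_
    have := Finset.mem_range.mp hk
    omega
  rw [Finset.sum_add_distrib] at h
  have a := Finset.sum_range_succ (fun k => ((n + 1).choose k : ℝ)⁻¹) (n + 1)
  have b := Finset.sum_range_succ' (fun k => ((n + 1).choose k : ℝ)⁻¹) (n + 1)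
  simp only [Nat.choose_self, Nat.choose_zero_right, Nat.cast_one, inv_one] at a b
  linarith

theorem rockett (n : ℕ) :
    ∑ k ∈ Finset.range (n + 1), (n.choose k : ℝ)⁻¹ =
      (((n : ℝ) + 1) / 2 ^ n) * ∑ j ∈ Finset.range (n + 1), 2 ^ j / ((j : ℝ) + 1) := by
  induction n with
  | zero => simp
  | succ n ih =>
    have h := rockett_rec n
    rw [ih] at h
    rw [Finset.sum_range_succ (fun j : ℕ => (2 : ℝ) ^ j / ((j : ℝ) + 1))]
    generalize ∑ j ∈ Finset.range (n + 1), (2 : ℝ) ^ j / ((j : ℝ) + 1) = T at *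
    have q : (n : ℝ) + 1 ≠ 0 := by positivity
    have q2 : (n : ℝ) + 1 + 1 ≠ 0 := by positivity
    refine mul_left_cancel₀ (two_ne_zero (α := ℝ)) (h.trans ?_)
    push_cast
    field_simp
    ring
end
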